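/- Let d ≥ 1 and let F be a holomorphic d×d-matrix-valued function on ℂ∖(−∞,0]. Then F is of class S⁻¹, i.e. (F(z) − F(z)*)/(z − conj(z)) is negative semidefinite whenever Im z ≠ 0 and F(x) is positive semidefinite for every real x > 0, if and only if there exist positive semidefinite d×d matrices A and C and a positive-matrix-valued Borel measure σ on (0,∞) with ∫_{(0,∞)} (1+t)^{-1} dσ(t) finite, such that F(z) = A + C/z + ∫_{(0,∞)} 1/(z+t) dσ(t) for all z ∈ ℂ∖(−∞,0]. -/

import Mathlib

open MeasureTheory
open scoped ComplexOrder ComplexConjugate Matrix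

section

open Filter Topology

section Representation

variable {X : Type*} [TopologicalSpace X] [CompactSpace X] [TopologicalSpace.MetrizableSpace X]
  [MeasurableSpace X] [BorelSpace X]

/-- Riesz–Markov–Kakutani on a compact space, for functionals on `C(X, ℝ)`. -/
lemma exists_measure_of_nonneg_functional (Λ : C(X, ℝ) →ₗ[ℝ] ℝ)
    (hΛ : ∀ φ : C(X, ℝ), 0 ≤ φ → 0 ≤ Λ φ) :
    ∃ μ : Measure X, IsFiniteMeasure μ ∧ ∀ φ : C(X, ℝ), ∫ x, φ x ∂μ = Λ φ := by
  let L : CompactlySupportedContinuousMap X ℝ →ₗ[ℝ] ℝ :=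
    { toFun := fun f => Λ (f : C(X, ℝ))
      map_add' := fun f g => Λ.map_add f g
      map_smul' := fun c f => Λ.map_smul c f }
  let P := PositiveLinearMap.mk₀ L (fun f hf => hΛ (f : C(X, ℝ)) hf)
  refine ⟨RealRMK.rieszMeasure P, inferInstance, fun φ => ?_⟩
  exact RealRMK.integral_rieszMeasure P (CompactlySupportedContinuousMap.continuousMapEquiv φ)

lemma ae_nonneg_of_forall_continuous_integral_nonneg (τ : Measure X) [IsFiniteMeasure τ]
    (f : X → ℝ) (hf : Integrable f τ)
    (h : ∀ φ : C(X, ℝ), 0 ≤ φ → 0 ≤ ∫ x, φ x * f x ∂τ) : ∀ᵐ x ∂τ, 0 ≤ f x := by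
  have closed : ∀ K : Set X, IsClosed K → 0 ≤ ∫ x in K, f x ∂τ := by
    intro K hK
    have key : Tendsto (fun n => ∫ x, ((hK.apprSeq n x : NNReal) : ℝ) * f x ∂τ) atTop
        (𝓝 (∫ x, K.indicator f x ∂τ)) := by
      refine tendsto_integral_of_dominated_convergence (fun x => ‖f x‖) (fun n => ?_) hf.norm
        (fun n => ?_) ?_
      · exact (Continuous.aestronglyMeasurable (by fun_prop)).mul hf.1
      · refine Eventually.of_forall fun x => ?_
        rw [norm_mul]
        refine mul_le_of_le_one_left (norm_nonneg _) ?_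
        simpa using HasOuterApproxClosed.apprSeq_apply_le_one hK n x
      · refine Eventually.of_forall fun x => ?_
        have h1 := tendsto_pi_nhds.1 (HasOuterApproxClosed.tendsto_apprSeq hK) x
        by_cases hx : x ∈ K
        · simp [hx, HasOuterApproxClosed.apprSeq_apply_eq_one hK]
        · have h2 : Tendsto (fun n => ((hK.apprSeq n x : NNReal) : ℝ)) atTop (𝓝 ((0 : NNReal) : ℝ)) := by
            refine (NNReal.tendsto_coe).2 ?_
            simpa [hx] using h1
          simpa [hx] using h2.mul_const (f x)
    rw [integral_indicator hK.measurableSet] at key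
    refine ge_of_tendsto' key fun n => ?_
    exact h ⟨fun x => ((hK.apprSeq n x : NNReal) : ℝ), by fun_prop⟩ (fun x => NNReal.coe_nonneg _)
  obtain ⟨g, hg, hfg⟩ := hf.1
  have hgm : MeasurableSet {x | g x < 0} := hg.measurable measurableSet_Iio
  suffices hs : τ {x | g x < 0} = 0 by
    have h1 : ∀ᵐ x ∂τ, 0 ≤ g x := by
      rw [ae_iff]; simpa using hs
    filter_upwards [h1, hfg] with x h1 h2
    rwa [h2]
  by_contra hne
  obtain ⟨K, hKs, hK, hpos⟩ := MeasurableSet.exists_lt_isClosed_of_ne_top hgm (measure_ne_top τ _) (pos_iff_ne_zero.2 hne)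
  have hgi : Integrable g τ := hf.congr hfg
  have h0 : 0 ≤ ∫ x in K, g x ∂τ := by
    rw [← integral_congr_ae (ae_restrict_of_ae hfg)]
    exact closed K hK
  have h1 : 0 < ∫ x in K, -g x ∂τ := by
    rw [setIntegral_pos_iff_support_of_nonneg_ae]
    · refine hpos.trans_le (measure_mono fun x hx => ⟨?_, hx⟩)
      have := hKs hx
      simp only [Set.mem_ofPred_eq] at this
      simp [this.ne]
    · refine (ae_restrict_iff' hK.measurableSet).2 (Eventually.of_forall fun x hx => ?_)
      have := hKs hx
      simp only [Set.mem_ofPred_eq] at this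
      simp [this.le]
    · exact hgi.neg.integrableOn
  rw [integral_neg] at h1
  linarith

lemma exists_common_density {ι : Type*} [Fintype ι] (Λ : ι → C(X, ℝ) →ₗ[ℝ] ℝ)
    (hΛ : ∀ k, ∀ φ : C(X, ℝ), 0 ≤ φ → 0 ≤ Λ k φ) :
    ∃ (τ : Measure X) (r : ι → X → ℝ), IsFiniteMeasure τ ∧ (∀ k, Integrable (r k) τ) ∧
      ∀ k, ∀ φ : C(X, ℝ), ∫ x, φ x * r k x ∂τ = Λ k φ := by
  choose μ hμ hμΛ using fun k => exists_measure_of_nonneg_functional (Λ k) (hΛ k)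
  have hac : ∀ k, μ k ≪ ∑ j, μ j := fun k =>
    Measure.absolutelyContinuous_of_le (Finset.single_le_sum (f := μ) (fun j _ => Measure.zero_le (μ j)) (Finset.mem_univ k))
  refine ⟨∑ k, μ k, fun k x => ((μ k).rnDeriv (∑ j, μ j) x).toReal, inferInstance, fun k => ?_,
    fun k φ => ?_⟩
  · exact Measure.integrable_toReal_rnDeriv
  · rw [← hμΛ k φ, ← integral_rnDeriv_smul (hac k)]
    simp [mul_comm]

lemma integral_star_dotProduct_mulVec {Y : Type*} [MeasurableSpace Y] {μ : Measure Y} {d : ℕ}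
    (H : Y → Matrix (Fin d) (Fin d) ℂ) (hH : ∀ i j, Integrable (fun y => H y i j) μ)
    (v : Fin d → ℂ) :
    Integrable (fun y => star v ⬝ᵥ H y *ᵥ v) μ ∧
    ∫ y, star v ⬝ᵥ H y *ᵥ v ∂μ = star v ⬝ᵥ (Matrix.of fun i j => ∫ y, H y i j ∂μ) *ᵥ v := by
  simp only [dotProduct, Matrix.mulVec, Matrix.of_apply]
  have h1 : ∀ i, Integrable (fun y => ∑ j, H y i j * v j) μ := fun i =>
    integrable_finsetSum _ fun j _ => (hH i j).mul_const _
  refine ⟨integrable_finsetSum _ fun i _ => (h1 i).const_mul _, ?_⟩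
  rw [integral_finsetSum _ fun i _ => (h1 i).const_mul _]
  refine Finset.sum_congr rfl fun i _ => ?_
  rw [integral_const_mul, integral_finsetSum _ fun j _ => (hH i j).mul_const _]
  simp_rw [integral_mul_const]

lemma Matrix.IsHermitian.posSemidef_of_re_nonneg {d : ℕ} {M : Matrix (Fin d) (Fin d) ℂ}
    (hM : M.IsHermitian) (h : ∀ v, 0 ≤ (star v ⬝ᵥ M *ᵥ v).re) : M.PosSemidef := by
  refine .of_dotProduct_mulVec_nonneg hM fun v => ?_
  rw [Complex.nonneg_iff]
  exact ⟨h v, (hM.im_star_dotProduct_mulVec_self v).symm⟩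

lemma posSemidef_integral {Y : Type*} [MeasurableSpace Y] {μ : Measure Y} {d : ℕ}
    (H : Y → Matrix (Fin d) (Fin d) ℂ) (hH : ∀ i j, Integrable (fun y => H y i j) μ)
    (hp : ∀ᵐ y ∂μ, (H y).PosSemidef) :
    (Matrix.of fun i j => ∫ y, H y i j ∂μ).PosSemidef := by
  refine Matrix.IsHermitian.posSemidef_of_re_nonneg ?_ fun v => ?_
  · ext i j
    simp only [Matrix.conjTranspose_apply, Matrix.of_apply, RCLike.star_def]
    rw [← integral_conj]
    refine integral_congr_ae ?_
    filter_upwards [hp] with y hy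
    exact hy.1.apply i j
  · obtain ⟨h1, h2⟩ := integral_star_dotProduct_mulVec H hH v
    rw [← h2, ← RCLike.re_eq_complex_re, ← integral_re h1]
    refine integral_nonneg_of_ae ?_
    filter_upwards [hp] with y hy
    exact (Complex.nonneg_iff.1 (hy.dotProduct_mulVec_nonneg v)).1

lemma star_dotProduct_mulVec_single_add {d : ℕ} (M : Matrix (Fin d) (Fin d) ℂ) (i j : Fin d)
    (c : ℂ) :
    star (Pi.single i 1 + c • Pi.single j 1) ⬝ᵥ M *ᵥ (Pi.single i 1 + c • Pi.single j 1)
      = M i i + c * M i j + conj c * M j i + conj c * c * M j j := by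
  simp [Matrix.mulVec_add, Matrix.mulVec_smul, add_dotProduct, dotProduct_add, smul_dotProduct,
    dotProduct_smul, star_add, star_smul]
  ring

lemma integral_sub_add_sub_div {Y : Type*} [MeasurableSpace Y] {μ : Measure Y}
    {f₁ f₂ f₃ f₄ : Y → ℝ} (h₁ : Integrable f₁ μ) (h₂ : Integrable f₂ μ) (h₃ : Integrable f₃ μ)
    (h₄ : Integrable f₄ μ) (c : ℝ) :
    ∫ y, (f₁ y - f₂ y + (f₃ y - f₄ y)) / c ∂μ =
      (∫ y, f₁ y ∂μ - ∫ y, f₂ y ∂μ + (∫ y, f₃ y ∂μ - ∫ y, f₄ y ∂μ)) / c := by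
  have h := integral_add (h₁.sub h₂) (h₃.sub h₄)
  simp only [Pi.sub_apply] at h
  rw [integral_div, h, integral_sub h₁ h₂, integral_sub h₃ h₄]

lemma exists_matrix_density {d : ℕ} (Λ : C(X, ℝ) →ₗ[ℝ] Matrix (Fin d) (Fin d) ℂ)
    (hΛ : ∀ φ : C(X, ℝ), 0 ≤ φ → (Λ φ).PosSemidef) :
    ∃ (τ : Measure X) (h : X → Matrix (Fin d) (Fin d) ℂ), IsFiniteMeasure τ ∧
      (∀ i j, Integrable (fun x => h x i j) τ) ∧ (∀ᵐ x ∂τ, (h x).PosSemidef) ∧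
      ∀ (φ : C(X, ℝ)) i j, ∫ x, (φ x : ℂ) * h x i j ∂τ = Λ φ i j := by
  let q : Fin d × Fin d × Fin 4 → C(X, ℝ) →ₗ[ℝ] ℝ := fun k =>
    { toFun := fun φ => (Λ φ k.1 k.1 + Complex.I ^ (k.2.2 : ℕ) * Λ φ k.1 k.2.1
          + conj (Complex.I ^ (k.2.2 : ℕ)) * Λ φ k.2.1 k.1
          + conj (Complex.I ^ (k.2.2 : ℕ)) * Complex.I ^ (k.2.2 : ℕ) * Λ φ k.2.1 k.2.1).re
      map_add' := fun φ ψ => by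
        rw [← Complex.add_re]
        congr 1
        simp only [map_add, Matrix.add_apply]
        ring
      map_smul' := fun c φ => by
        simp only [map_smul, Matrix.smul_apply, RingHom.id_apply, smul_eq_mul]
        rw [← Complex.re_ofReal_mul]
        congr 1
        simp only [Complex.real_smul]
        ring }
  obtain ⟨τ, r, hτ, hr, hrq⟩ := exists_common_density q (fun k φ hφ => by
    have := (hΛ φ hφ).dotProduct_mulVec_nonneg
      (Pi.single k.1 1 + Complex.I ^ (k.2.2 : ℕ) • Pi.single k.2.1 1)
    rw [star_dotProduct_mulVec_single_add] at this
    exact (Complex.nonneg_iff.1 this).1)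
  let a : Fin d → Fin d → X → ℝ := fun i j x =>
    (r (i, j, 0) x - r (i, j, 2) x + (r (j, i, 0) x - r (j, i, 2) x)) / 8
  let b : Fin d → Fin d → X → ℝ := fun i j x =>
    (r (i, j, 3) x - r (i, j, 1) x - (r (j, i, 3) x - r (j, i, 1) x)) / 8
  have ha : ∀ i j, Integrable (a i j) τ := fun i j =>
    ((((hr _).sub (hr _)).add ((hr _).sub (hr _))).div_const 8)
  have hb : ∀ i j, Integrable (b i j) τ := fun i j =>
    ((((hr _).sub (hr _)).sub ((hr _).sub (hr _))).div_const 8)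
  have hφi : ∀ (φ : C(X, ℝ)) (f : X → ℝ), Integrable f τ → Integrable (fun x => φ x * f x) τ :=
    fun φ f hf => hf.bdd_mul (c := ‖φ‖) φ.continuous.aestronglyMeasurable
      (Eventually.of_forall fun x => φ.norm_coe_le_norm x)
  have hherm : ∀ φ : C(X, ℝ), (Λ φ).IsHermitian := by
    intro φ
    have h1 : φ = (φ ⊔ 0) - ((-φ) ⊔ 0) := by
      ext x
      simp [max_def]
      split_ifs <;> linarith
    rw [h1, map_sub]
    exact (hΛ _ le_sup_right).1.sub (hΛ _ le_sup_right).1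
  have hqv : ∀ φ k, (q k φ) = (Λ φ k.1 k.1 + Complex.I ^ (k.2.2 : ℕ) * Λ φ k.1 k.2.1
          + conj (Complex.I ^ (k.2.2 : ℕ)) * Λ φ k.2.1 k.1
          + conj (Complex.I ^ (k.2.2 : ℕ)) * Complex.I ^ (k.2.2 : ℕ) * Λ φ k.2.1 k.2.1).re :=
    fun φ k => rfl
  have hga : ∀ (φ : C(X, ℝ)) i j, ∫ x, φ x * a i j x ∂τ = (Λ φ i j).re := by
    intro φ i j
    have e : ∀ x, φ x * a i j x = (φ x * r (i, j, 0) x - φ x * r (i, j, 2) x +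
      (φ x * r (j, i, 0) x - φ x * r (j, i, 2) x)) / 8 := fun x => by simp only [a]; ring
    have hi := fun k => hφi φ _ (hr k)
    simp_rw [e]
    rw [integral_sub_add_sub_div (hi _) (hi _) (hi _) (hi _)]
    simp only [hrq, hqv]
    have h2 := (hherm φ).apply i j
    rw [← h2]
    simp [pow_succ]
    ring
  have hgb : ∀ (φ : C(X, ℝ)) i j, ∫ x, φ x * b i j x ∂τ = (Λ φ i j).im := by
    intro φ i j
    have e : ∀ x, φ x * b i j x = (φ x * r (i, j, 3) x - φ x * r (i, j, 1) x +
      (φ x * r (j, i, 1) x - φ x * r (j, i, 3) x)) / 8 := fun x => by simp only [b]; ring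
    have hi := fun k => hφi φ _ (hr k)
    simp_rw [e]
    rw [integral_sub_add_sub_div (hi _) (hi _) (hi _) (hi _)]
    simp only [hrq, hqv]
    have h2 := (hherm φ).apply i j
    rw [← h2]
    simp [pow_succ]
    ring
  have hinteg : ∀ i j, Integrable (fun x => (a i j x : ℂ) + b i j x * Complex.I) τ := fun i j =>
    (ha i j).ofReal.add ((hb i j).ofReal.mul_const _)
  have hrep : ∀ (φ : C(X, ℝ)) i j,
      ∫ x, (φ x : ℂ) * ((a i j x : ℂ) + b i j x * Complex.I) ∂τ = Λ φ i j := by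
    intro φ i j
    have e : ∀ x, (φ x : ℂ) * ((a i j x : ℂ) + b i j x * Complex.I)
      = ((φ x * a i j x : ℝ) : ℂ) + ((φ x * b i j x : ℝ) : ℂ) * Complex.I := fun x => by
        push_cast; ring
    simp_rw [e]
    rw [integral_add (hφi φ _ (ha i j)).ofReal ((hφi φ _ (hb i j)).ofReal.mul_const _),
      integral_mul_const, integral_complex_ofReal, integral_complex_ofReal, hga, hgb, Complex.re_add_im]
  let h : X → Matrix (Fin d) (Fin d) ℂ := fun x =>
    Matrix.of fun i j => (a i j x : ℂ) + b i j x * Complex.I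
  have hhh : ∀ x, (h x).IsHermitian := by
    intro x
    ext i j
    simp only [h, a, b, Matrix.conjTranspose_apply, Matrix.of_apply]
    apply Complex.ext <;> simp <;> ring
  refine ⟨τ, h, hτ, hinteg, ?_, hrep⟩
  have hv : ∀ v : Fin d → ℂ, ∀ᵐ x ∂τ, 0 ≤ (star v ⬝ᵥ h x *ᵥ v).re := by
    intro v
    refine ae_nonneg_of_forall_continuous_integral_nonneg τ _
      (integral_star_dotProduct_mulVec h hinteg v).1.re fun φ hφ => ?_
    have h1 := integral_star_dotProduct_mulVec (μ := τ) (fun x => (φ x : ℂ) • h x) (fun i j => by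
      exact (hinteg i j).bdd_mul (c := ‖φ‖) (Continuous.aestronglyMeasurable (by fun_prop))
        (Eventually.of_forall fun x => by simpa using φ.norm_coe_le_norm x)) v
    have h2 : (Matrix.of fun i j => ∫ x, ((φ x : ℂ) • h x) i j ∂τ) = Λ φ := by
      ext i j
      exact hrep φ i j
    rw [h2] at h1
    have h3 := (Complex.nonneg_iff.1 ((hΛ φ hφ).dotProduct_mulVec_nonneg v)).1
    rw [← h1.2, ← RCLike.re_eq_complex_re, ← integral_re h1.1] at h3
    simpa [Matrix.smul_mulVec, dotProduct_smul] using h3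
  have hall := ae_all_iff.2 fun n => hv (TopologicalSpace.denseSeq (Fin d → ℂ) n)
  filter_upwards [hall] with x hx
  refine (hhh x).posSemidef_of_re_nonneg fun v => ?_
  have hc : IsClosed {v : Fin d → ℂ | 0 ≤ (star v ⬝ᵥ h x *ᵥ v).re} := by
    refine isClosed_le continuous_const (Complex.continuous_re.comp ?_)
    unfold dotProduct Matrix.mulVec dotProduct
    fun_prop
  exact (TopologicalSpace.denseRange_denseSeq (Fin d → ℂ)).induction_on (p := fun v => 0 ≤ (star v ⬝ᵥ h x *ᵥ v).re) v hc hx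

end Representation

lemma Matrix.PosSemidef.norm_apply_le {d : ℕ} {M : Matrix (Fin d) (Fin d) ℂ}
    (hM : M.PosSemidef) (i j : Fin d) : ‖M i j‖ ≤ (M i i).re + (M j j).re := by
  have key := fun c : ℂ => (Complex.nonneg_iff.1
    (hM.dotProduct_mulVec_nonneg (Pi.single i 1 + c • Pi.single j 1))).1
  simp only [star_dotProduct_mulVec_single_add] at key
  have h1 := key 1
  have h2 := key (-1)
  have h3 := key Complex.I
  have h4 := key (-Complex.I)
  rw [← hM.1.apply j i] at h1 h2 h3 h4
  simp at h1 h2 h3 h4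
  refine (Complex.norm_le_abs_re_add_abs_im _).trans ?_
  have h5 : |(M i j).re| ≤ ((M i i).re + (M j j).re) / 2 := abs_le.2 ⟨by linarith, by linarith⟩
  have h6 : |(M i j).im| ≤ ((M i i).re + (M j j).re) / 2 := abs_le.2 ⟨by linarith, by linarith⟩
  linarith

lemma Matrix.posSemidef_of_tendsto {ι : Type*} {l : Filter ι} [l.NeBot] {d : ℕ}
    {M : ι → Matrix (Fin d) (Fin d) ℂ} {N : Matrix (Fin d) (Fin d) ℂ}
    (hM : ∀ n, (M n).PosSemidef) (h : ∀ i j, Tendsto (fun n => M n i j) l (𝓝 (N i j))) :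
    N.PosSemidef := by
  refine Matrix.IsHermitian.posSemidef_of_re_nonneg ?_ fun v => ?_
  · ext i j
    refine tendsto_nhds_unique ((h j i).star) ((h i j).congr fun n => ?_)
    exact ((hM n).1.apply i j).symm
  · have ht : Tendsto (fun n => (star v ⬝ᵥ M n *ᵥ v).re) l (𝓝 (star v ⬝ᵥ N *ᵥ v).re) := by
      refine (Complex.continuous_re.tendsto _).comp ?_
      simp only [dotProduct, Matrix.mulVec]
      exact tendsto_finsetSum _ fun i _ => (tendsto_finsetSum _ fun j _ =>
        (h i j).mul_const _).const_mul _
    exact ge_of_tendsto' ht fun n =>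
      (Complex.nonneg_iff.1 ((hM n).dotProduct_mulVec_nonneg v)).1

lemma exists_ultrafilter_limit {X : Type*} [TopologicalSpace X] [CompactSpace X] {d : ℕ}
    (Λ : ℕ → C(X, ℝ) →ₗ[ℝ] Matrix (Fin d) (Fin d) ℂ)
    (hΛ : ∀ n, ∀ φ : C(X, ℝ), 0 ≤ φ → (Λ n φ).PosSemidef)
    (hb : ∀ φ i j, ∃ B, ∀ n, ‖Λ n φ i j‖ ≤ B) :
    ∃ (l : Ultrafilter ℕ) (L : C(X, ℝ) →ₗ[ℝ] Matrix (Fin d) (Fin d) ℂ),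
      (l : Filter ℕ) ≤ atTop ∧ (∀ φ : C(X, ℝ), 0 ≤ φ → (L φ).PosSemidef) ∧
      ∀ φ i j, Tendsto (fun n => Λ n φ i j) l (𝓝 (L φ i j)) := by
  let l : Ultrafilter ℕ := Ultrafilter.of atTop
  have hex : ∀ φ i j, ∃ y, Tendsto (fun n => Λ n φ i j) l (𝓝 y) := by
    intro φ i j
    obtain ⟨B, hB⟩ := hb φ i j
    obtain ⟨y, -, hy⟩ := (isCompact_closedBall (0 : ℂ) B).ultrafilter_le_nhds
      (l.map fun n => Λ n φ i j) (by
        rw [le_principal_iff]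
        refine Filter.mem_map.2 (Filter.Eventually.of_forall fun n => ?_)
        simpa using hB n)
    exact ⟨y, hy⟩
  choose L hL using hex
  let L' : C(X, ℝ) →ₗ[ℝ] Matrix (Fin d) (Fin d) ℂ :=
    { toFun := fun φ => Matrix.of (L φ)
      map_add' := fun φ ψ => by
        ext i j
        refine tendsto_nhds_unique (hL (φ + ψ) i j) (((hL φ i j).add (hL ψ i j)).congr fun n => ?_)
        simp
      map_smul' := fun c φ => by
        ext i j
        refine tendsto_nhds_unique (hL (c • φ) i j) (((hL φ i j).const_smul c).congr fun n => ?_)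
        simp }
  exact ⟨l, L', Ultrafilter.of_le _,
    fun φ hφ => Matrix.posSemidef_of_tendsto (fun n => hΛ n φ hφ) (hL φ), hL⟩

lemma integral_circle_mul_sin_kernel {f : ℂ → ℂ}
    (hf : DifferentiableOn ℂ f (Metric.closedBall 0 1)) {ξ : ℂ} (hξ : ‖ξ‖ < 1) :
    ∫ θ in (0 : ℝ)..2 * Real.pi, f (Complex.exp (θ * Complex.I)) *
        (Real.sin θ * (ξ / (1 - 2 * ξ * Real.cos θ + ξ ^ 2)))
      = Real.pi * Complex.I * (f ξ - f 0) := by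
  have hne : ∀ ζ ∈ Metric.closedBall (0 : ℂ) 1, 1 - ξ * ζ ≠ 0 := by
    intro ζ hζ h0
    have h1 : ‖ξ * ζ‖ < 1 := by
      rw [norm_mul]
      have : ‖ζ‖ ≤ 1 := by simpa using hζ
      nlinarith [norm_nonneg ξ, norm_nonneg ζ]
    rw [← sub_eq_zero.1 h0] at h1
    simp at h1
  have hg : DifferentiableOn ℂ (fun ζ => f ζ * (ξ / (1 - ξ * ζ))) (Metric.closedBall 0 1) :=
    hf.mul ((differentiableOn_const _).div (by fun_prop) hne)
  have I1 := hf.circleIntegral_sub_inv_smul (w := 0) (by simp)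
  have I2 := hf.circleIntegral_sub_inv_smul (w := ξ) (by simpa using hξ)
  have I3 : ∮ ζ in C(0, 1), f ζ * (ξ / (1 - ξ * ζ)) = 0 :=
    Complex.circleIntegral_eq_zero_of_differentiable_on_off_countable zero_le_one
      Set.countable_empty hg.continuousOn fun z hz => by
        refine hg.differentiableAt (Filter.mem_of_superset (Metric.isOpen_ball.mem_nhds hz.1)
          Metric.ball_subset_closedBall)
  have hsub : Metric.sphere (0 : ℂ) 1 ⊆ Metric.closedBall 0 1 := Metric.sphere_subset_closedBall
  have c1 : CircleIntegrable (fun ζ => (ζ - 0)⁻¹ • f ζ) 0 1 := by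
    refine ContinuousOn.circleIntegrable zero_le_one (ContinuousOn.smul
      (ContinuousOn.inv₀ (continuousOn_id.sub continuousOn_const) fun ζ hζ => ?_) (hf.continuousOn.mono hsub))
    have : ‖ζ‖ = 1 := by simpa using hζ
    have h0 : ζ ≠ 0 := by
      rw [← norm_ne_zero_iff, this]
      exact one_ne_zero
    simpa using h0
  have hξζ : ∀ ζ : ℂ, ‖ζ‖ = 1 → ζ - ξ ≠ 0 := by
    intro ζ h1 h0
    rw [sub_eq_zero.1 h0] at h1
    linarith
  have c2 : CircleIntegrable (fun ζ => (ζ - ξ)⁻¹ • f ζ) 0 1 := by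
    refine ContinuousOn.circleIntegrable zero_le_one (ContinuousOn.smul
      (ContinuousOn.inv₀ (continuousOn_id.sub continuousOn_const) fun ζ hζ => ?_) (hf.continuousOn.mono hsub))
    exact hξζ ζ (by simpa using hζ)
  have c3 : CircleIntegrable (fun ζ => f ζ * (ξ / (1 - ξ * ζ))) 0 1 :=
    ContinuousOn.circleIntegrable zero_le_one (hg.continuousOn.mono hsub)
  have tot : ∮ ζ in C(0, 1), ((ζ - 0)⁻¹ • f ζ - (ζ - ξ)⁻¹ • f ζ + f ζ * (ξ / (1 - ξ * ζ)))
      = 2 * Real.pi * Complex.I * (f 0 - f ξ) := by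
    have h := circleIntegral.integral_add (c1.sub c2) c3
    simp only [Pi.sub_apply] at h
    rw [h, circleIntegral.integral_sub c1 c2, I1, I2, I3]
    simp only [smul_eq_mul]
    ring
  have hpt : ∀ θ : ℝ, deriv (circleMap 0 1) θ • ((circleMap 0 1 θ - 0)⁻¹ • f (circleMap 0 1 θ)
      - (circleMap 0 1 θ - ξ)⁻¹ • f (circleMap 0 1 θ)
      + f (circleMap 0 1 θ) * (ξ / (1 - ξ * circleMap 0 1 θ)))
      = (-2) * (f (Complex.exp (θ * Complex.I)) *
        (Real.sin θ * (ξ / (1 - 2 * ξ * Real.cos θ + ξ ^ 2)))) := by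
    intro θ
    have hz1 : ‖Complex.exp (θ * Complex.I)‖ = 1 := Complex.norm_exp_ofReal_mul_I θ
    have hc : circleMap 0 1 θ = Complex.exp (θ * Complex.I) := by simp [circleMap]
    have hd : deriv (circleMap 0 1) θ = Complex.exp (θ * Complex.I) * Complex.I := by
      rw [deriv_circleMap, hc]
    rw [hd, hc]
    have hcos : (Real.cos θ : ℂ) = (Complex.exp (θ * Complex.I) + (Complex.exp (θ * Complex.I))⁻¹) / 2 := by
      rw [Complex.ofReal_cos, Complex.cos, ← Complex.exp_neg, neg_mul]
    have hsin : (Real.sin θ : ℂ) = ((Complex.exp (θ * Complex.I))⁻¹ - Complex.exp (θ * Complex.I)) * Complex.I / 2 := by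
      rw [Complex.ofReal_sin, Complex.sin, ← Complex.exp_neg, neg_mul]
    rw [hcos, hsin]
    set ζ := Complex.exp (θ * Complex.I) with hζ
    have h0 : ζ ≠ 0 := Complex.exp_ne_zero _
    have h1 := hξζ ζ hz1
    have h2 := hne ζ (by simp [hz1])
    have h2' : 1 - ζ * ξ ≠ 0 := by rwa [mul_comm]
    have h3 : 1 - 2 * ξ * ((ζ + ζ⁻¹) / 2) + ξ ^ 2 = (1 - ξ * ζ) * (ζ - ξ) / ζ := by
      field_simp
      ring
    rw [h3, sub_zero]
    simp only [smul_eq_mul]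
    field_simp
    ring
  rw [circleIntegral] at tot
  simp_rw [hpt] at tot
  rw [intervalIntegral.integral_const_mul] at tot
  linear_combination (-1 / 2) * tot

/-- The square of the Cayley transform, mapping the unit disc conformally onto the slit plane. -/
noncomputable def discToSlit (η : ℂ) : ℂ := ((1 + η) / (1 - η)) ^ 2

lemma one_sub_ne_zero_of_norm_lt_one {η : ℂ} (hη : ‖η‖ < 1) : 1 - η ≠ 0 := by
  intro h
  rw [← sub_eq_zero.1 h] at hη
  simp at hη

lemma re_cayley_pos {η : ℂ} (hη : ‖η‖ < 1) : 0 < ((1 + η) / (1 - η)).re := by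
  have h0 : 0 < Complex.normSq (1 - η) := Complex.normSq_pos.2 (one_sub_ne_zero_of_norm_lt_one hη)
  have h1 : Complex.normSq η < 1 := by
    rw [Complex.normSq_eq_norm_sq]
    nlinarith [norm_nonneg η]
  rw [Complex.normSq_apply] at h1
  rw [Complex.div_re, ← add_div]
  refine div_pos ?_ h0
  simp
  nlinarith

lemma im_cayley (η : ℂ) : ((1 + η) / (1 - η)).im = 2 * η.im / Complex.normSq (1 - η) := by
  rw [Complex.div_im, ← sub_div]
  congr 1
  simp
  ring

lemma sq_mem_slitPlane {q : ℂ} (hq : 0 < q.re) : q ^ 2 ∈ Complex.slitPlane := by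
  rw [Complex.mem_slitPlane_iff]
  simp only [pow_two, Complex.mul_re, Complex.mul_im]
  by_cases h : q.im = 0
  · left; rw [h]; nlinarith
  · right
    have := mul_ne_zero hq.ne' h
    intro h'
    apply this
    linarith

lemma discToSlit_mem {η : ℂ} (hη : ‖η‖ < 1) : discToSlit η ∈ Complex.slitPlane :=
  sq_mem_slitPlane (re_cayley_pos hη)

lemma im_discToSlit_mul_nonneg {η : ℂ} (hη : ‖η‖ < 1) : 0 ≤ η.im * (discToSlit η).im := by
  have h : (discToSlit η).im
      = 2 * ((1 + η) / (1 - η)).re * (2 * η.im / Complex.normSq (1 - η)) := by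
    rw [← im_cayley, discToSlit, pow_two, Complex.mul_im]
    ring
  rw [h]
  have h1 := (re_cayley_pos hη).le
  have h2 := Complex.normSq_nonneg (1 - η)
  have : η.im * (2 * ((1 + η) / (1 - η)).re * (2 * η.im / Complex.normSq (1 - η)))
    = 4 * ((1 + η) / (1 - η)).re * (η.im ^ 2 / Complex.normSq (1 - η)) := by ring
  rw [this]
  positivity

lemma differentiableOn_discToSlit : DifferentiableOn ℂ discToSlit (Metric.ball 0 1) := by
  refine DifferentiableOn.pow (DifferentiableOn.div (by fun_prop) (by fun_prop) fun η hη => ?_) 2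
  exact one_sub_ne_zero_of_norm_lt_one (by simpa using hη)

lemma exists_discToSlit_eq {z : ℂ} (hz : z ∈ Complex.slitPlane) :
    ∃ ξ : ℂ, ‖ξ‖ < 1 ∧ discToSlit ξ = z := by
  have hz0 : z ≠ 0 := Complex.slitPlane_ne_zero hz
  obtain ⟨q, hq, hqz⟩ : ∃ q : ℂ, 0 < q.re ∧ q ^ 2 = z := by
    refine ⟨Complex.exp (Complex.log z / 2), ?_, ?_⟩
    · rw [Complex.exp_re]
      refine mul_pos (Real.exp_pos _) (Real.cos_pos_of_mem_Ioo ?_)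
      have h1 := Complex.neg_pi_lt_log_im z
      have h2 := (Complex.mem_slitPlane_iff_arg.1 hz).1
      have h3 := Complex.log_im_le_pi z
      have h4 : (Complex.log z).im ≠ Real.pi := by rwa [Complex.log_im]
      have h5 : (Complex.log z / 2).im = (Complex.log z).im / 2 := by simp
      rw [h5]
      have := lt_of_le_of_ne h3 h4
      constructor <;> linarith
    · rw [← Complex.exp_nat_mul]
      push_cast
      rw [mul_div_cancel₀ _ (two_ne_zero), Complex.exp_log hz0]
  have hq1 : q + 1 ≠ 0 := by
    intro h
    have := congrArg Complex.re h
    simp at this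
    linarith
  refine ⟨(q - 1) / (q + 1), ?_, ?_⟩
  · rw [norm_div, div_lt_one (norm_pos_iff.2 hq1)]
    refine lt_of_pow_lt_pow_left₀ 2 (norm_nonneg _) ?_
    rw [← Complex.normSq_eq_norm_sq, ← Complex.normSq_eq_norm_sq, Complex.normSq_apply,
      Complex.normSq_apply]
    simp
    nlinarith
  · rw [discToSlit, ← hqz]
    congr 1
    field_simp
    ring

lemma discToSlit_kernel {ξ : ℂ} (hξ : ‖ξ‖ < 1) (c : ℂ) :
    4 * (ξ / (1 - 2 * ξ * c + ξ ^ 2))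
      = (discToSlit ξ - 1) * (1 / (1 + (1 - c) / 2 * (discToSlit ξ - 1))) := by
  have h := one_sub_ne_zero_of_norm_lt_one hξ
  have h1 : discToSlit ξ - 1 = 4 * ξ / (1 - ξ) ^ 2 := by
    rw [discToSlit]
    field_simp
    ring
  have h2 : 1 + (1 - c) / 2 * (4 * ξ / (1 - ξ) ^ 2) = (1 - 2 * ξ * c + ξ ^ 2) / (1 - ξ) ^ 2 := by
    field_simp
    ring
  rw [h1, h2, mul_one_div, div_div_div_cancel_right₀ (pow_ne_zero 2 h), mul_div_assoc]

lemma one_add_mul_sub_one_ne_zero {z : ℂ} (hz : z ∈ Complex.slitPlane) {s : ℝ}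
    (hs : s ∈ Set.Icc (0 : ℝ) 1) : 1 + (s : ℂ) * (z - 1) ≠ 0 := by
  intro h
  have h1 := congrArg Complex.re h
  have h2 := congrArg Complex.im h
  simp at h1 h2
  rcases h2 with h2 | h2
  · rw [h2] at h1; simp at h1
  · rcases Complex.mem_slitPlane_iff.1 hz with h3 | h3
    · rcases hs.1.eq_or_lt with h4 | h4
      · rw [← h4] at h1; simp at h1
      · nlinarith [hs.2, mul_pos h4 h3]
    · exact h3 h2

/-- Schwarz reflection on the slit plane. -/
lemma apply_conj_of_isHermitian_real {d : ℕ} {F : ℂ → Matrix (Fin d) (Fin d) ℂ}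
    (hF : ∀ i j, DifferentiableOn ℂ (fun z => F z i j) Complex.slitPlane)
    (hr : ∀ x : ℝ, 0 < x → (F (x : ℂ)).IsHermitian) {z : ℂ} (hz : z ∈ Complex.slitPlane)
    (i j : Fin d) : F (conj z) i j = conj (F z j i) := by
  have hconj : ∀ w ∈ Complex.slitPlane, conj w ∈ Complex.slitPlane := by
    intro w hw
    rw [Complex.mem_slitPlane_iff] at hw ⊢
    simpa using hw
  have ho := Complex.isOpen_slitPlane
  have h1 : AnalyticOnNhd ℂ (fun z => F z i j) Complex.slitPlane :=
    (hF i j).analyticOnNhd ho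
  have h2 : AnalyticOnNhd ℂ (fun z => conj (F (conj z) j i)) Complex.slitPlane := by
    refine DifferentiableOn.analyticOnNhd (fun w hw => ?_) ho
    refine DifferentiableAt.differentiableWithinAt ?_
    have h3 : DifferentiableAt ℂ (fun z => F z j i) (conj w) :=
      (hF j i).differentiableAt (ho.mem_nhds (hconj w hw))
    have := h3.conj_conj
    simp only [Complex.conj_conj] at this
    exact this
  have h1s : (1 : ℂ) ∈ Complex.slitPlane := by simp
  have hpc : IsPreconnected Complex.slitPlane :=
    (Complex.starConvex_one_slitPlane.isPathConnected h1s).isConnected.isPreconnected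
  have hfr : ∃ᶠ w in 𝓝[≠] (1 : ℂ), F w i j = conj (F (conj w) j i) := by
    have ht : Tendsto (fun n : ℕ => ((1 + 1 / ((n : ℝ) + 1) : ℝ) : ℂ)) atTop (𝓝[≠] (1 : ℂ)) := by
      refine tendsto_nhdsWithin_iff.2 ⟨?_, Eventually.of_forall fun n => ?_⟩
      · have := (tendsto_one_div_add_atTop_nhds_zero_nat (𝕜 := ℝ)).const_add 1
        rw [add_zero] at this
        exact_mod_cast (Complex.continuous_ofReal.tendsto 1).comp this
      · simp only [Set.mem_compl_iff, Set.mem_singleton_iff]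
        intro h
        have h' : (1 + 1 / ((n : ℝ) + 1) : ℝ) = 1 := by exact_mod_cast h
        have : (0 : ℝ) < 1 / ((n : ℝ) + 1) := by positivity
        linarith
    refine ht.frequently (Filter.Frequently.of_forall fun n => ?_)
    rw [Complex.conj_ofReal]
    exact ((hr _ (by positivity)).apply i j).symm
  have := h1.eqOn_of_preconnected_of_frequently_eq h2 hpc h1s hfr (hconj z hz)
  simpa using this

/-- Boundary density of the approximating measure on the circle of radius `ρ`. -/
noncomputable def circleDensity {d : ℕ} (F : ℂ → Matrix (Fin d) (Fin d) ℂ) (ρ θ : ℝ) :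
    Matrix (Fin d) (Fin d) ℂ :=
  (-((Real.sin θ : ℂ) / (8 * Real.pi * Complex.I))) •
    (F (discToSlit (ρ * Complex.exp (θ * Complex.I)))
      - (F (discToSlit (ρ * Complex.exp (θ * Complex.I))))ᴴ)

/-- The Stieltjes class `S⁻¹`. -/
def IsStieltjes {d : ℕ} (F : ℂ → Matrix (Fin d) (Fin d) ℂ) : Prop :=
  (∀ z ∈ Complex.slitPlane, z.im ≠ 0 → (-((z - conj z)⁻¹ • (F z - (F z)ᴴ))).PosSemidef) ∧
    ∀ x : ℝ, 0 < x → (F (x : ℂ)).PosSemidef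

lemma norm_ofReal_mul_exp_lt_one {ρ : ℝ} (h0 : 0 < ρ) (h1 : ρ < 1) (θ : ℝ) :
    ‖(ρ : ℂ) * Complex.exp (θ * Complex.I)‖ < 1 := by
  rw [norm_mul, Complex.norm_exp_ofReal_mul_I, mul_one, Complex.norm_real, Real.norm_eq_abs,
    abs_of_pos h0]
  exact h1

lemma circleDensity_posSemidef {d : ℕ} {F : ℂ → Matrix (Fin d) (Fin d) ℂ} (hS : IsStieltjes F)
    {ρ : ℝ} (h0 : 0 < ρ) (h1 : ρ < 1) (θ : ℝ) : (circleDensity F ρ θ).PosSemidef := by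
  have hn := norm_ofReal_mul_exp_lt_one h0 h1 θ
  have him := im_discToSlit_mul_nonneg hn
  have hmem := discToSlit_mem hn
  rw [circleDensity]
  have hηim : ((ρ : ℂ) * Complex.exp (θ * Complex.I)).im = ρ * Real.sin θ := by
    rw [Complex.im_ofReal_mul, Complex.exp_ofReal_mul_I_im]
  rw [hηim] at him
  set z := discToSlit (ρ * Complex.exp (θ * Complex.I)) with hz
  by_cases hzi : z.im = 0
  · have hzr : ((z.re : ℝ) : ℂ) = z := Complex.ext (by simp) (by simp [hzi])
    have hpos : 0 < z.re := by
      rcases Complex.mem_slitPlane_iff.1 hmem with h | h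
      · exact h
      · exact absurd hzi h
    have := (hS.2 _ hpos).1
    rw [hzr] at this
    rw [this.eq, sub_self, smul_zero]
    exact Matrix.PosSemidef.zero
  · have h2 := hS.1 z hmem hzi
    have hc : (0 : ℝ) ≤ Real.sin θ * z.im / (4 * Real.pi) := by
      have : 0 ≤ Real.sin θ * z.im := by
        by_contra hneg
        push Not at hneg
        nlinarith
      positivity
    have h3 := h2.smul (a := ((Real.sin θ * z.im / (4 * Real.pi) : ℝ) : ℂ)) (by exact_mod_cast hc)
    convert h3 using 1
    rw [← neg_smul, smul_smul, Complex.sub_conj]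
    congr 1
    have hzi' : (z.im : ℂ) ≠ 0 := by exact_mod_cast hzi
    have hpi : (Real.pi : ℂ) ≠ 0 := by exact_mod_cast Real.pi_ne_zero
    push_cast
    field_simp
    ring

lemma continuous_apply_discToSlit {d : ℕ} {F : ℂ → Matrix (Fin d) (Fin d) ℂ}
    (hF : ∀ i j, DifferentiableOn ℂ (fun z => F z i j) Complex.slitPlane)
    {ρ : ℝ} (h0 : 0 < ρ) (h1 : ρ < 1) (i j : Fin d) :
    Continuous fun θ : ℝ => F (discToSlit (ρ * Complex.exp (θ * Complex.I))) i j := by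
  have hc : ContinuousOn (fun η => F (discToSlit η) i j) (Metric.ball 0 1) :=
    (hF i j).continuousOn.comp differentiableOn_discToSlit.continuousOn
      fun η hη => discToSlit_mem (by simpa using hη)
  exact hc.comp_continuous (f := fun θ : ℝ => (ρ : ℂ) * Complex.exp (θ * Complex.I)) (by fun_prop)
    fun θ => by simpa using norm_ofReal_mul_exp_lt_one h0 h1 θ

lemma continuous_circleDensity {d : ℕ} {F : ℂ → Matrix (Fin d) (Fin d) ℂ}
    (hF : ∀ i j, DifferentiableOn ℂ (fun z => F z i j) Complex.slitPlane)
    {ρ : ℝ} (h0 : 0 < ρ) (h1 : ρ < 1) (i j : Fin d) :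
    Continuous fun θ : ℝ => circleDensity F ρ θ i j := by
  simp only [circleDensity, Matrix.smul_apply, Matrix.sub_apply, Matrix.conjTranspose_apply,
    smul_eq_mul]
  refine Continuous.mul (by fun_prop) ?_
  exact (continuous_apply_discToSlit hF h0 h1 i j).sub
    (continuous_apply_discToSlit hF h0 h1 j i).star

lemma integral_circleDensity_mul_kernel {d : ℕ} {F : ℂ → Matrix (Fin d) (Fin d) ℂ}
    (hF : ∀ i j, DifferentiableOn ℂ (fun z => F z i j) Complex.slitPlane) (hS : IsStieltjes F)
    {ρ : ℝ} (h0 : 0 < ρ) (h1 : ρ < 1) {ξ : ℂ} (hξ : ‖ξ‖ < 1) (i j : Fin d) :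
    ∫ θ in (0 : ℝ)..2 * Real.pi,
        circleDensity F ρ θ i j * (4 * (ξ / (1 - 2 * ξ * Real.cos θ + ξ ^ 2)))
      = F 1 i j - F (discToSlit (ρ * ξ)) i j := by
  have hscale : ∀ ζ : ℂ, ‖ζ‖ ≤ 1 → ‖(ρ : ℂ) * ζ‖ < 1 := by
    intro ζ hζ
    rw [norm_mul, Complex.norm_real, Real.norm_eq_abs, abs_of_pos h0]
    nlinarith [norm_nonneg ζ]
  have hd : ∀ i j, DifferentiableOn ℂ (fun ζ => F (discToSlit (ρ * ζ)) i j)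
      (Metric.closedBall 0 1) := by
    intro i j
    refine (hF i j).comp (differentiableOn_discToSlit.comp (f := fun ζ : ℂ => (ρ : ℂ) * ζ)
      (by fun_prop) fun ζ hζ => ?_) fun ζ hζ => discToSlit_mem (hscale ζ (by simpa using hζ))
    simpa using hscale ζ (by simpa using hζ)
  have hone : discToSlit ((ρ : ℂ) * 0) = 1 := by simp [discToSlit]
  have hF1 : conj (F 1 j i) = F 1 i j := by
    have := (hS.2 1 one_pos).1.apply i j
    simpa using this
  have hk : ∀ θ : ℝ, Complex.exp (θ * Complex.I) ≠ 0 := fun θ => Complex.exp_ne_zero _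
  have hden : ∀ (ξ : ℂ), ‖ξ‖ < 1 → ∀ θ : ℝ, 1 - 2 * ξ * (Real.cos θ : ℂ) + ξ ^ 2 ≠ 0 := by
    intro ξ hξ θ h
    have e : (1 - 2 * ξ * (Real.cos θ : ℂ) + ξ ^ 2)
        = (1 - ξ * Complex.exp (θ * Complex.I)) * (1 - ξ * Complex.exp (-(θ * Complex.I))) := by
      rw [Complex.ofReal_cos, Complex.cos, neg_mul]
      have := Complex.exp_add (θ * Complex.I) (-(θ * Complex.I))
      rw [add_neg_cancel, Complex.exp_zero] at this
      linear_combination ξ ^ 2 * this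
    rw [e] at h
    have hlt : ∀ w : ℂ, ‖w‖ = 1 → ‖ξ * w‖ < 1 := fun w hw => by rw [norm_mul, hw, mul_one]; exact hξ
    rcases mul_eq_zero.1 h with h | h
    · exact one_sub_ne_zero_of_norm_lt_one (hlt _ (Complex.norm_exp_ofReal_mul_I θ)) h
    · refine one_sub_ne_zero_of_norm_lt_one (hlt _ ?_) h
      have := Complex.norm_exp_ofReal_mul_I (-θ)
      rwa [Complex.ofReal_neg, neg_mul] at this
  have I1 := integral_circle_mul_sin_kernel (hd i j) hξ
  have hξ' : ‖conj ξ‖ < 1 := by simpa using hξ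
  have I2 := congrArg conj (integral_circle_mul_sin_kernel (hd j i) hξ')
  rw [← intervalIntegral.intervalIntegral_conj] at I2
  have hsymm : conj (F (discToSlit (ρ * conj ξ)) j i) = F (discToSlit (ρ * ξ)) i j := by
    have e : discToSlit (ρ * conj ξ) = conj (discToSlit (ρ * ξ)) := by simp [discToSlit]
    rw [e, apply_conj_of_isHermitian_real hF (fun x hx => (hS.2 x hx).1)
      (discToSlit_mem (hscale ξ hξ.le)) j i, Complex.conj_conj]
  simp only [map_mul, map_sub, map_div₀, map_add, map_one, map_pow, Complex.conj_ofReal,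
    Complex.conj_conj, Complex.conj_I, map_ofNat, hsymm, hone, hF1] at I1 I2
  have hkc : Continuous fun θ : ℝ => (Real.sin θ : ℂ) * (ξ / (1 - 2 * ξ * Real.cos θ + ξ ^ 2)) := by
    refine Continuous.mul (by fun_prop) (Continuous.div (by fun_prop) (by fun_prop) (hden ξ hξ))
  have hi1 : IntervalIntegrable (fun θ : ℝ => F (discToSlit (ρ * Complex.exp (θ * Complex.I))) i j
      * (Real.sin θ * (ξ / (1 - 2 * ξ * Real.cos θ + ξ ^ 2)))) volume 0 (2 * Real.pi) :=
    ((continuous_apply_discToSlit hF h0 h1 i j).mul hkc).intervalIntegrable _ _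
  have hi2 : IntervalIntegrable (fun θ : ℝ =>
      conj (F (discToSlit (ρ * Complex.exp (θ * Complex.I))) j i)
      * (Real.sin θ * (ξ / (1 - 2 * ξ * Real.cos θ + ξ ^ 2)))) volume 0 (2 * Real.pi) :=
    ((continuous_apply_discToSlit hF h0 h1 j i).star.mul hkc).intervalIntegrable _ _
  have hsub := intervalIntegral.integral_sub hi1 hi2
  rw [I1, I2] at hsub
  have hpi : (Real.pi : ℂ) ≠ 0 := by exact_mod_cast Real.pi_ne_zero
  have hpt : ∀ θ : ℝ, circleDensity F ρ θ i j * (4 * (ξ / (1 - 2 * ξ * Real.cos θ + ξ ^ 2)))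
      = (-(1 / (2 * Real.pi * Complex.I))) *
        (F (discToSlit (ρ * Complex.exp (θ * Complex.I))) i j
          * (Real.sin θ * (ξ / (1 - 2 * ξ * Real.cos θ + ξ ^ 2)))
        - conj (F (discToSlit (ρ * Complex.exp (θ * Complex.I))) j i)
          * (Real.sin θ * (ξ / (1 - 2 * ξ * Real.cos θ + ξ ^ 2)))) := by
    intro θ
    simp only [circleDensity, Matrix.smul_apply, Matrix.sub_apply, Matrix.conjTranspose_apply,
      smul_eq_mul, RCLike.star_def]
    have := hden ξ hξ θ
    field_simp
    ring
  simp_rw [hpt]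
  rw [intervalIntegral.integral_const_mul, hsub]
  field_simp
  ring

/-- The parametrization `θ ↦ (1 - cos θ) / 2` of the unit interval. -/
noncomputable def haversine (θ : ℝ) : unitInterval :=
  ⟨(1 - Real.cos θ) / 2, by
    constructor
    · linarith [Real.cos_le_one θ]
    · linarith [Real.neg_one_le_cos θ]⟩

lemma continuous_haversine : Continuous haversine :=
  Continuous.subtype_mk (by fun_prop) _

lemma integral_re_circleDensity_le {d : ℕ} {F : ℂ → Matrix (Fin d) (Fin d) ℂ}
    (hF : ∀ i j, DifferentiableOn ℂ (fun z => F z i j) Complex.slitPlane) (hS : IsStieltjes F)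
    {ρ : ℝ} (h0 : 0 < ρ) (h1 : ρ < 1) (i : Fin d) :
    ∫ θ in (0 : ℝ)..2 * Real.pi, (circleDensity F ρ θ i i).re ≤ 2 * (F 1 i i).re := by
  have hW := fun θ => circleDensity_posSemidef hS h0 h1 θ
  have hWi : ∀ θ, 0 ≤ (circleDensity F ρ θ i i).re := fun θ =>
    (Complex.nonneg_iff.1 (hW θ).diag_nonneg).1
  have hWc : ∀ θ, circleDensity F ρ θ i i = ((circleDensity F ρ θ i i).re : ℂ) := fun θ =>
    Complex.ext (by simp) (by simpa using (Complex.nonneg_iff.1 (hW θ).diag_nonneg).2.symm)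
  have hcont : Continuous fun θ => (circleDensity F ρ θ i i).re :=
    Complex.continuous_re.comp (continuous_circleDensity hF h0 h1 i i)
  have hI := integral_circleDensity_mul_kernel hF hS h0 h1 (ξ := ((1 / 2 : ℝ) : ℂ))
    (by rw [Complex.norm_real]; norm_num) i i
  have hker : ∀ θ : ℝ, circleDensity F ρ θ i i * (4 * (((1 / 2 : ℝ) : ℂ) /
      (1 - 2 * ((1 / 2 : ℝ) : ℂ) * Real.cos θ + ((1 / 2 : ℝ) : ℂ) ^ 2)))
      = (((circleDensity F ρ θ i i).re * (2 / (5 / 4 - Real.cos θ)) : ℝ) : ℂ) := by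
    intro θ
    conv_lhs => rw [hWc θ]
    push_cast
    rw [show (1 : ℂ) - 2 * (1 / 2) * Complex.cos θ + (1 / 2) ^ 2 = 5 / 4 - Complex.cos θ by ring]
    ring
  simp_rw [hker] at hI
  rw [intervalIntegral.integral_ofReal] at hI
  have hz : discToSlit (ρ * ((1 / 2 : ℝ) : ℂ))
      = (((1 + ρ * (1 / 2)) / (1 - ρ * (1 / 2))) ^ 2 : ℝ) := by
    simp [discToSlit]
  have hzpos : 0 < ((1 + ρ * (1 / 2)) / (1 - ρ * (1 / 2))) ^ 2 := by
    have : 0 < (1 + ρ * (1 / 2)) / (1 - ρ * (1 / 2)) := div_pos (by linarith) (by linarith)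
    positivity
  have hFz := (Complex.nonneg_iff.1 ((hS.2 _ hzpos).diag_nonneg (i := i))).1
  have hre := congrArg Complex.re hI
  rw [hz, Complex.ofReal_re, Complex.sub_re] at hre
  have hpi := Real.pi_pos
  have hmono : ∫ θ in (0 : ℝ)..2 * Real.pi, (circleDensity F ρ θ i i).re
      ≤ ∫ θ in (0 : ℝ)..2 * Real.pi,
        2 * ((circleDensity F ρ θ i i).re * (2 / (5 / 4 - Real.cos θ))) := by
    have hden : ∀ θ, 5 / 4 - Real.cos θ ≠ 0 := fun θ => by
      have := Real.cos_le_one θ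
      intro h
      linarith
    refine intervalIntegral.integral_mono_on (by positivity) (hcont.intervalIntegrable _ _)
      (Continuous.intervalIntegrable ?_ _ _) fun θ _ => ?_
    · exact continuous_const.mul (hcont.mul (continuous_const.div (by fun_prop) hden))
    · have h2 : 1 / 2 ≤ 2 / (5 / 4 - Real.cos θ) := by
        have := Real.cos_le_one θ
        have := Real.neg_one_le_cos θ
        rw [div_le_div_iff₀ (by norm_num) (by linarith)]
        linarith
      nlinarith [hWi θ]
  rw [intervalIntegral.integral_const_mul, hre] at hmono
  linarith

lemma exists_circleFunctional {d : ℕ} {F : ℂ → Matrix (Fin d) (Fin d) ℂ}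
    (hF : ∀ i j, DifferentiableOn ℂ (fun z => F z i j) Complex.slitPlane) (hS : IsStieltjes F)
    {ρ : ℝ} (h0 : 0 < ρ) (h1 : ρ < 1) :
    ∃ Λ : C(unitInterval, ℝ) →ₗ[ℝ] Matrix (Fin d) (Fin d) ℂ,
      (∀ φ, 0 ≤ φ → (Λ φ).PosSemidef) ∧
      (∀ φ i j, Λ φ i j
        = ∫ θ in (0 : ℝ)..2 * Real.pi, (φ (haversine θ) : ℂ) * circleDensity F ρ θ i j) ∧
      ∀ φ i j, ‖Λ φ i j‖ ≤ ‖φ‖ * (2 * (F 1 i i).re + 2 * (F 1 j j).re) := by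
  have hpi : (0 : ℝ) ≤ 2 * Real.pi := by positivity
  have hcont : ∀ (φ : C(unitInterval, ℝ)) (i j : Fin d),
      Continuous fun θ : ℝ => (φ (haversine θ) : ℂ) * circleDensity F ρ θ i j := fun φ i j =>
    (Complex.continuous_ofReal.comp (φ.continuous.comp continuous_haversine)).mul
      (continuous_circleDensity hF h0 h1 i j)
  have hcre : ∀ i, Continuous fun θ => (circleDensity F ρ θ i i).re := fun i =>
    Complex.continuous_re.comp (continuous_circleDensity hF h0 h1 i i)
  let Λ : C(unitInterval, ℝ) →ₗ[ℝ] Matrix (Fin d) (Fin d) ℂ :=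
    { toFun := fun φ => Matrix.of fun i j =>
        ∫ θ in (0 : ℝ)..2 * Real.pi, (φ (haversine θ) : ℂ) * circleDensity F ρ θ i j
      map_add' := fun φ ψ => by
        ext i j
        simp only [Matrix.of_apply, Matrix.add_apply]
        rw [← intervalIntegral.integral_add ((hcont φ i j).intervalIntegrable _ _)
          ((hcont ψ i j).intervalIntegrable _ _)]
        simp [add_mul]
      map_smul' := fun c φ => by
        ext i j
        simp only [Matrix.of_apply, Matrix.smul_apply, RingHom.id_apply]
        rw [← intervalIntegral.integral_smul]
        simp [mul_assoc] }
  have hΛ : ∀ φ i j, Λ φ i j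
      = ∫ θ in (0 : ℝ)..2 * Real.pi, (φ (haversine θ) : ℂ) * circleDensity F ρ θ i j :=
    fun φ i j => rfl
  refine ⟨Λ, fun φ hφ => ?_, hΛ, fun φ i j => ?_⟩
  · have := posSemidef_integral (μ := volume.restrict (Set.Ioc 0 (2 * Real.pi)))
      (fun θ => (φ (haversine θ) : ℂ) • circleDensity F ρ θ)
      (fun i j => ((hcont φ i j).intervalIntegrable 0 (2 * Real.pi)).1)
      (Eventually.of_forall fun θ =>
        (circleDensity_posSemidef hS h0 h1 θ).smul (by exact_mod_cast hφ (haversine θ)))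
    convert this using 1
    ext i j
    rw [hΛ, intervalIntegral.integral_of_le hpi]
    rfl
  · rw [hΛ]
    have hb : ∀ θ, ‖(φ (haversine θ) : ℂ) * circleDensity F ρ θ i j‖
        ≤ ‖φ‖ * ((circleDensity F ρ θ i i).re + (circleDensity F ρ θ j j).re) := by
      intro θ
      rw [norm_mul, Complex.norm_real]
      exact mul_le_mul (φ.norm_coe_le_norm _)
        ((circleDensity_posSemidef hS h0 h1 θ).norm_apply_le i j) (norm_nonneg _) (norm_nonneg _)
    refine (intervalIntegral.norm_integral_le_of_norm_le hpi
      (Eventually.of_forall fun θ _ => hb θ) (Continuous.intervalIntegrable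
        (continuous_const.mul ((hcre i).add (hcre j))) _ _)).trans ?_
    rw [intervalIntegral.integral_const_mul, intervalIntegral.integral_add
      ((hcre i).intervalIntegrable _ _) ((hcre j).intervalIntegrable _ _)]
    exact mul_le_mul_of_nonneg_left (add_le_add (integral_re_circleDensity_le hF hS h0 h1 i)
      (integral_re_circleDensity_le hF hS h0 h1 j)) (norm_nonneg _)

/-- The continuous kernel `s ↦ 1 / (1 + s (z - 1))` on the unit interval. -/
noncomputable def slitKernel {z : ℂ} (hz : z ∈ Complex.slitPlane) : C(unitInterval, ℂ) where
  toFun s := 1 / (1 + ((s : ℝ) : ℂ) * (z - 1))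
  continuous_toFun := continuous_const.div (by fun_prop) fun s =>
    one_add_mul_sub_one_ne_zero hz s.2

/-- An integral representation of Stieltjes functions over the unit interval. -/
lemma IsStieltjes.exists_unitInterval_representation {d : ℕ} {F : ℂ → Matrix (Fin d) (Fin d) ℂ}
    (hF : ∀ i j, DifferentiableOn ℂ (fun z => F z i j) Complex.slitPlane) (hS : IsStieltjes F) :
    ∃ (τ : Measure unitInterval) (h : unitInterval → Matrix (Fin d) (Fin d) ℂ),
      IsFiniteMeasure τ ∧ (∀ i j, Integrable (fun s => h s i j) τ) ∧
      (∀ᵐ s ∂τ, (h s).PosSemidef) ∧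
      ∀ z ∈ Complex.slitPlane, ∀ i j,
        F z i j = F 1 i j - (z - 1) * ∫ s, 1 / (1 + ((s : ℝ) : ℂ) * (z - 1)) * h s i j ∂τ := by
  let ρ : ℕ → ℝ := fun n => 1 - 1 / (n + 2)
  have hρ0 : ∀ n, 0 < ρ n := fun n => by
    have : 1 / ((n : ℝ) + 2) < 1 := by rw [div_lt_one (by positivity)]; linarith [n.cast_nonneg (α := ℝ)]
    simp only [ρ]; linarith
  have hρ1 : ∀ n, ρ n < 1 := fun n => by
    have : 0 < 1 / ((n : ℝ) + 2) := by positivity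
    simp only [ρ]; linarith
  have hρt : Tendsto ρ atTop (𝓝 1) := by
    have h2 : Tendsto (fun n : ℕ => 1 / ((n : ℝ) + 2)) atTop (𝓝 0) := by
      have := tendsto_one_div_add_atTop_nhds_zero_nat (𝕜 := ℝ)
      refine ((tendsto_add_atTop_iff_nat 1).2 this).congr fun n => ?_
      push_cast
      ring
    simpa [ρ] using (tendsto_const_nhds (x := (1 : ℝ))).sub h2
  choose Λ hpos hinteg hb using fun n => exists_circleFunctional hF hS (hρ0 n) (hρ1 n)
  obtain ⟨l, L, hl, hLpos, hL⟩ := exists_ultrafilter_limit Λ hpos fun φ i j => ⟨_, fun n => hb n φ i j⟩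
  obtain ⟨τ, h, hτ, hhi, hhp, hhL⟩ := exists_matrix_density L hLpos
  refine ⟨τ, h, hτ, hhi, hhp, fun z hz i j => ?_⟩
  obtain ⟨ξ, hξ, hξz⟩ := exists_discToSlit_eq hz
  let kre : C(unitInterval, ℝ) := ⟨fun s => (slitKernel hz s).re, by fun_prop⟩
  let kim : C(unitInterval, ℝ) := ⟨fun s => (slitKernel hz s).im, by fun_prop⟩
  have hk : ∀ s : unitInterval, 1 / (1 + ((s : ℝ) : ℂ) * (z - 1)) = (kre s : ℂ) + kim s * Complex.I := fun s =>
    (Complex.re_add_im (slitKernel hz s)).symm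
  have hsplit : ∀ n, (z - 1) * (Λ n kre i j + Λ n kim i j * Complex.I)
      = F 1 i j - F (discToSlit (ρ n * ξ)) i j := by
    intro n
    have hc : ∀ φ : C(unitInterval, ℝ), Continuous fun θ : ℝ =>
        (φ (haversine θ) : ℂ) * circleDensity F (ρ n) θ i j := fun φ =>
      (Complex.continuous_ofReal.comp (φ.continuous.comp continuous_haversine)).mul
        (continuous_circleDensity hF (hρ0 n) (hρ1 n) i j)
    rw [← integral_circleDensity_mul_kernel hF hS (hρ0 n) (hρ1 n) hξ i j, hinteg, hinteg,
      ← intervalIntegral.integral_mul_const, ← intervalIntegral.integral_add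
        ((hc kre).intervalIntegrable _ _)
        (Continuous.intervalIntegrable (by simpa using (hc kim).mul_const Complex.I) _ _),
      ← intervalIntegral.integral_const_mul]
    refine intervalIntegral.integral_congr fun θ _ => ?_
    have hθ := hk (haversine θ)
    have : (((haversine θ : unitInterval) : ℝ) : ℂ) = (1 - (Real.cos θ : ℂ)) / 2 := by
      simp [haversine]
    rw [this] at hθ
    rw [discToSlit_kernel hξ, hξz, hθ]
    ring
  have hlim1 : Tendsto (fun n => (z - 1) * (Λ n kre i j + Λ n kim i j * Complex.I)) l
      (𝓝 ((z - 1) * (L kre i j + L kim i j * Complex.I))) :=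
    ((hL kre i j).add ((hL kim i j).mul_const _)).const_mul _
  have hlim2 : Tendsto (fun n => F 1 i j - F (discToSlit (ρ n * ξ)) i j) l
      (𝓝 (F 1 i j - F z i j)) := by
    refine tendsto_const_nhds.sub ?_
    have ht : Tendsto (fun n => (ρ n : ℂ) * ξ) l (𝓝 ξ) := by
      have := ((Complex.continuous_ofReal.tendsto 1).comp (hρt.mono_left hl)).mul_const ξ
      simpa using this
    have hc1 : ContinuousAt discToSlit ξ :=
      differentiableOn_discToSlit.continuousOn.continuousAt
        (Metric.isOpen_ball.mem_nhds (by simpa using hξ))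
    have hc2 : ContinuousAt (fun z => F z i j) (discToSlit ξ) :=
      (hF i j).continuousOn.continuousAt
        (Complex.isOpen_slitPlane.mem_nhds (discToSlit_mem hξ))
    have := (hc2.tendsto.comp hc1.tendsto).comp ht
    rwa [hξz] at this
  simp_rw [hsplit] at hlim1
  have heq := tendsto_nhds_unique hlim1 hlim2
  have hiφ : ∀ φ : C(unitInterval, ℝ), Integrable (fun s => (φ s : ℂ) * h s i j) τ := fun φ =>
    (hhi i j).bdd_mul (c := ‖φ‖) (Complex.continuous_ofReal.comp φ.continuous).aestronglyMeasurable
      (Eventually.of_forall fun s => by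
        simp only [Complex.norm_real]; exact φ.norm_coe_le_norm s)
  have hfin : ∫ s, 1 / (1 + ((s : ℝ) : ℂ) * (z - 1)) * h s i j ∂τ
      = L kre i j + L kim i j * Complex.I := by
    rw [← hhL, ← hhL, ← integral_mul_const, ← integral_add (hiφ kre) ((hiφ kim).mul_const _)]
    refine integral_congr_ae (Eventually.of_forall fun s => ?_)
    simp only
    rw [hk s]
    ring
  rw [hfin, heq]
  ring

lemma lintegral_inv_mul_le {X : Type*} [MeasurableSpace X] {τ : Measure X} {s q : X → ℝ} {c : ℝ}
    (hs : Measurable s) (hs0 : ∀ x, 0 ≤ s x) (hq : Integrable q τ) (hq0 : ∀ᵐ x ∂τ, 0 ≤ q x)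
    (h : ∀ n : ℕ, ∫ x, 1 / (1 / ((n : ℝ) + 1) + s x) * q x ∂τ ≤ c) :
    ∫⁻ x, (ENNReal.ofReal (s x))⁻¹ * ENNReal.ofReal (q x) ∂τ ≤ ENNReal.ofReal c := by
  have hpos : ∀ (n : ℕ) x, 0 < 1 / ((n : ℝ) + 1) + s x := fun n x =>
    add_pos_of_pos_of_nonneg (by positivity) (hs0 x)
  have hn : ∀ n : ℕ, ∫⁻ x, (ENNReal.ofReal (1 / ((n : ℝ) + 1) + s x))⁻¹ * ENNReal.ofReal (q x) ∂τ
      ≤ ENNReal.ofReal c := by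
    intro n
    refine le_trans (le_of_eq ?_) (ENNReal.ofReal_le_ofReal (h n))
    rw [ofReal_integral_eq_lintegral_ofReal]
    · refine lintegral_congr fun x => ?_
      rw [ENNReal.ofReal_mul (one_div_pos.2 (hpos n x)).le, one_div (1 / ((n : ℝ) + 1) + s x),
        ENNReal.ofReal_inv_of_pos (hpos n x)]
    · refine hq.bdd_mul (c := (n : ℝ) + 1)
        (Measurable.aestronglyMeasurable (measurable_const.div (by fun_prop))) (Eventually.of_forall fun x => ?_)
      rw [Real.norm_eq_abs, abs_of_pos (one_div_pos.2 (hpos n x))]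
      calc 1 / (1 / ((n : ℝ) + 1) + s x) ≤ 1 / (1 / ((n : ℝ) + 1)) :=
            one_div_le_one_div_of_le (by positivity) (by linarith [hs0 x])
        _ = (n : ℝ) + 1 := one_div_one_div _
    · filter_upwards [hq0] with x hx
      exact mul_nonneg (one_div_pos.2 (hpos n x)).le hx
  have hlim : ∀ x, Tendsto (fun n : ℕ =>
      (ENNReal.ofReal (1 / ((n : ℝ) + 1) + s x))⁻¹ * ENNReal.ofReal (q x)) atTop
      (𝓝 ((ENNReal.ofReal (s x))⁻¹ * ENNReal.ofReal (q x))) := by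
    intro x
    refine ENNReal.Tendsto.mul_const ?_ (Or.inr ENNReal.ofReal_ne_top)
    refine tendsto_inv_iff.2 (ENNReal.tendsto_ofReal ?_)
    simpa using (tendsto_one_div_add_atTop_nhds_zero_nat (𝕜 := ℝ)).add_const (s x)
  calc ∫⁻ x, (ENNReal.ofReal (s x))⁻¹ * ENNReal.ofReal (q x) ∂τ
      = ∫⁻ x, liminf (fun n : ℕ =>
          (ENNReal.ofReal (1 / ((n : ℝ) + 1) + s x))⁻¹ * ENNReal.ofReal (q x)) atTop ∂τ :=
        lintegral_congr fun x => (hlim x).liminf_eq.symm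
    _ ≤ liminf (fun n : ℕ => ∫⁻ x,
          (ENNReal.ofReal (1 / ((n : ℝ) + 1) + s x))⁻¹ * ENNReal.ofReal (q x) ∂τ) atTop :=
        lintegral_liminf_le' fun n => AEMeasurable.mul (by fun_prop)
          hq.aestronglyMeasurable.aemeasurable.ennreal_ofReal
    _ ≤ ENNReal.ofReal c := liminf_le_of_le (by isBoundedDefault) fun b hb => by
        obtain ⟨n, hbn⟩ := hb.exists
        exact hbn.trans (hn n)

/-- If `∫ q / (ε + s) ≤ c` uniformly as `ε → 0`, then `q / s` is integrable with integral at most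
`c`, and `q` vanishes where `s` does. -/
lemma integrable_inv_mul_of_integral_le {X : Type*} [MeasurableSpace X] {τ : Measure X}
    {s q : X → ℝ} {c : ℝ} (hs : Measurable s) (hs0 : ∀ x, 0 ≤ s x) (hq : Integrable q τ)
    (hq0 : ∀ᵐ x ∂τ, 0 ≤ q x) (hc : 0 ≤ c)
    (h : ∀ n : ℕ, ∫ x, 1 / (1 / ((n : ℝ) + 1) + s x) * q x ∂τ ≤ c) :
    Integrable (fun x => (s x)⁻¹ * q x) τ ∧ ∫ x, (s x)⁻¹ * q x ∂τ ≤ c ∧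
      ∀ᵐ x ∂τ, s x = 0 → q x = 0 := by
  have hle := lintegral_inv_mul_le hs hs0 hq hq0 h
  have hqm := hq.aestronglyMeasurable.aemeasurable
  have hnn : ∀ᵐ x ∂τ, 0 ≤ (s x)⁻¹ * q x := by
    filter_upwards [hq0] with x hx
    exact mul_nonneg (inv_nonneg.2 (hs0 x)) hx
  have hmeas : AEMeasurable (fun x => (s x)⁻¹ * q x) τ := by fun_prop
  have hle2 : ∫⁻ x, ENNReal.ofReal ((s x)⁻¹ * q x) ∂τ ≤ ENNReal.ofReal c := by
    refine (lintegral_mono fun x => ?_).trans hle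
    rcases (hs0 x).eq_or_lt with h0 | h0
    · simp [← h0]
    · rw [ENNReal.ofReal_mul (inv_nonneg.2 (hs0 x)), ENNReal.ofReal_inv_of_pos h0]
  have hinteg : Integrable (fun x => (s x)⁻¹ * q x) τ := by
    refine ⟨hmeas.aestronglyMeasurable, ?_⟩
    rw [hasFiniteIntegral_iff_ofReal hnn]
    exact hle2.trans_lt ENNReal.ofReal_lt_top
  refine ⟨hinteg, ?_, ?_⟩
  · rw [← ofReal_integral_eq_lintegral_ofReal hinteg hnn] at hle2
    exact (ENNReal.ofReal_le_ofReal_iff hc).1 hle2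
  · filter_upwards [hq0, ae_lt_top' (by fun_prop) (hle.trans_lt ENNReal.ofReal_lt_top).ne]
      with x hx hfin hsx
    rw [hsx, ENNReal.ofReal_zero, ENNReal.inv_zero] at hfin
    by_contra hne
    rw [ENNReal.top_mul (ENNReal.ofReal_pos.2 (lt_of_le_of_ne hx (Ne.symm hne))).ne'] at hfin
    exact lt_irrefl _ hfin

lemma norm_slitKernel_le {z : ℂ} (hz : z ∈ Complex.slitPlane) (s : unitInterval) :
    ‖1 / (1 + ((s : ℝ) : ℂ) * (z - 1))‖ ≤ ‖slitKernel hz‖ :=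
  (slitKernel hz).norm_coe_le_norm s

lemma integrable_slitKernel_mul {z : ℂ} (hz : z ∈ Complex.slitPlane) {τ : Measure unitInterval}
    {f : unitInterval → ℂ} (hf : Integrable f τ) :
    Integrable (fun s : unitInterval => 1 / (1 + ((s : ℝ) : ℂ) * (z - 1)) * f s) τ :=
  hf.bdd_mul (slitKernel hz).continuous.aestronglyMeasurable
    (Eventually.of_forall (norm_slitKernel_le hz))

/-- A compactified form of the Stieltjes integral representation. -/
lemma IsStieltjes.exists_compact_representation {d : ℕ} {F : ℂ → Matrix (Fin d) (Fin d) ℂ}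
    (hF : ∀ i j, DifferentiableOn ℂ (fun z => F z i j) Complex.slitPlane) (hS : IsStieltjes F) :
    ∃ (A : Matrix (Fin d) (Fin d) ℂ) (τ : Measure unitInterval)
      (k : unitInterval → Matrix (Fin d) (Fin d) ℂ),
      A.PosSemidef ∧ IsFiniteMeasure τ ∧ (∀ i j, Integrable (fun s => k s i j) τ) ∧
      (∀ᵐ s ∂τ, (k s).PosSemidef) ∧ k 0 = 0 ∧
      ∀ z ∈ Complex.slitPlane, ∀ i j,
        F z i j = A i j + ∫ s, 1 / (1 + ((s : ℝ) : ℂ) * (z - 1)) * k s i j ∂τ := by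
  obtain ⟨τ, h, hτ, hhi, hhp, hrep⟩ := hS.exists_unitInterval_representation hF
  have hM : (F 1).PosSemidef := by simpa using hS.2 1 one_pos
  have hqb : ∀ v : Fin d → ℂ,
      Integrable (fun s : unitInterval => (s : ℝ)⁻¹ * (star v ⬝ᵥ h s *ᵥ v).re) τ ∧
      ∫ s : unitInterval, (s : ℝ)⁻¹ * (star v ⬝ᵥ h s *ᵥ v).re ∂τ ≤ (star v ⬝ᵥ F 1 *ᵥ v).re ∧
      ∀ᵐ s : unitInterval ∂τ, (s : ℝ) = 0 → (star v ⬝ᵥ h s *ᵥ v).re = 0 := by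
    intro v
    refine integrable_inv_mul_of_integral_le (s := fun s : unitInterval => (s : ℝ)) (by fun_prop)
      (fun s => s.2.1) (integral_star_dotProduct_mulVec h hhi v).1.re ?_
      (Complex.nonneg_iff.1 (hM.dotProduct_mulVec_nonneg v)).1 fun n => ?_
    · filter_upwards [hhp] with s hs
      exact (Complex.nonneg_iff.1 (hs.dotProduct_mulVec_nonneg v)).1
    · have hx : (0 : ℝ) < n + 2 := by positivity
      have hz : (((n : ℝ) + 2 : ℝ) : ℂ) ∈ Complex.slitPlane := Complex.ofReal_mem_slitPlane.2 hx
      let H : unitInterval → Matrix (Fin d) (Fin d) ℂ := fun s =>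
        ((1 / (1 / ((n : ℝ) + 1) + (s : ℝ)) : ℝ) : ℂ) • h s
      have hHe : ∀ s i j, H s i j = ((((n : ℝ) + 2 : ℝ) : ℂ) - 1) *
          (1 / (1 + ((s : ℝ) : ℂ) * ((((n : ℝ) + 2 : ℝ) : ℂ) - 1)) * h s i j) := by
        intro s i j
        have hn1 : (0 : ℝ) < n + 1 := by positivity
        have hn2 : (0 : ℝ) < 1 + (s : ℝ) * (n + 1) :=
          add_pos_of_pos_of_nonneg one_pos (mul_nonneg s.2.1 hn1.le)
        have hreal : 1 / (1 / ((n : ℝ) + 1) + (s : ℝ))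
            = (n + 2 - 1) * (1 / (1 + (s : ℝ) * (n + 2 - 1))) := by
          have : (n : ℝ) + 2 - 1 = n + 1 := by ring
          rw [this]
          have : 0 < 1 / ((n : ℝ) + 1) + (s : ℝ) :=
            add_pos_of_pos_of_nonneg (by positivity) s.2.1
          rw [← div_eq_mul_one_div, div_eq_div_iff this.ne' hn2.ne']
          field_simp
        simp only [H, Matrix.smul_apply, smul_eq_mul]
        rw [hreal]
        push_cast
        ring
      have hHi : ∀ i j, Integrable (fun s => H s i j) τ := fun i j => by
        simp only [hHe]
        exact (integrable_slitKernel_mul hz (hhi i j)).const_mul _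
      have hFM : (Matrix.of fun i j => ∫ s, H s i j ∂τ) = F 1 - F (((n : ℝ) + 2 : ℝ) : ℂ) := by
        ext i j
        simp only [Matrix.of_apply, Matrix.sub_apply, hHe]
        rw [integral_const_mul, hrep _ hz i j]
        ring
      have hv := integral_star_dotProduct_mulVec H hHi v
      rw [hFM, Matrix.sub_mulVec, dotProduct_sub] at hv
      have hre := congrArg Complex.re hv.2
      have e1 : (∫ s, star v ⬝ᵥ H s *ᵥ v ∂τ).re = ∫ s, (star v ⬝ᵥ H s *ᵥ v).re ∂τ :=
        (integral_re hv.1).symm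
      rw [e1, Complex.sub_re] at hre
      have e2 : ∀ s, (star v ⬝ᵥ H s *ᵥ v).re
          = 1 / (1 / ((n : ℝ) + 1) + (s : ℝ)) * (star v ⬝ᵥ h s *ᵥ v).re := by
        intro s
        simp only [H, Matrix.smul_mulVec, dotProduct_smul, smul_eq_mul, Complex.re_ofReal_mul]
      simp_rw [e2] at hre
      have := (Complex.nonneg_iff.1 ((hS.2 _ hx).dotProduct_mulVec_nonneg v)).1
      rw [hre]
      linarith
  have hdiag : ∀ s i, star (Pi.single i (1 : ℂ)) ⬝ᵥ h s *ᵥ (Pi.single i 1) = h s i i := by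
    intro s i
    simp [dotProduct, Pi.single_apply]
  let k : unitInterval → Matrix (Fin d) (Fin d) ℂ := fun s => (((s : ℝ)⁻¹ : ℝ) : ℂ) • h s
  have hkm : ∀ i j, AEStronglyMeasurable (fun s => k s i j) τ := fun i j =>
    AEStronglyMeasurable.mul (f := fun s : unitInterval => (((s : ℝ)⁻¹ : ℝ) : ℂ))
      (Measurable.aestronglyMeasurable (by fun_prop)) (hhi i j).aestronglyMeasurable
  have hki : ∀ i j, Integrable (fun s => k s i j) τ := by
    intro i j
    have hi := (hqb (Pi.single i 1)).1
    have hj := (hqb (Pi.single j 1)).1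
    simp only [hdiag] at hi hj
    refine (hi.add hj).mono' (hkm i j) ?_
    filter_upwards [hhp] with s hs
    simp only [k, Matrix.smul_apply, smul_eq_mul, norm_mul, Complex.norm_real, Pi.add_apply]
    rw [← mul_add, Real.norm_eq_abs, abs_of_nonneg (inv_nonneg.2 s.2.1)]
    exact mul_le_mul_of_nonneg_left (hs.norm_apply_le i j) (inv_nonneg.2 s.2.1)
  have hkp : ∀ᵐ s ∂τ, (k s).PosSemidef := by
    filter_upwards [hhp] with s hs
    exact hs.smul (by exact_mod_cast inv_nonneg.2 s.2.1)
  have hk0 : ∀ᵐ s : unitInterval ∂τ, ∀ i j, h s i j = ((s : ℝ) : ℂ) * k s i j := by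
    have hz : ∀ᵐ s : unitInterval ∂τ, ∀ i, (s : ℝ) = 0 → (h s i i).re = 0 :=
      ae_all_iff.2 fun i => by simpa only [hdiag] using (hqb (Pi.single i 1)).2.2
    filter_upwards [hz, hhp] with s hs hp i j
    simp only [k, Matrix.smul_apply, smul_eq_mul]
    by_cases h0 : (s : ℝ) = 0
    · have := hp.norm_apply_le i j
      rw [hs i h0, hs j h0, add_zero] at this
      rw [norm_le_zero_iff.1 this]
      simp
    · have : ((s : ℝ) : ℂ) ≠ 0 := by exact_mod_cast h0
      push_cast
      field_simp
  have hKpos := posSemidef_integral k hki hkp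
  refine ⟨F 1 - Matrix.of fun i j => ∫ s, k s i j ∂τ, τ, k, ?_, hτ, hki, hkp, ?_, ?_⟩
  · refine Matrix.IsHermitian.posSemidef_of_re_nonneg (hM.1.sub hKpos.1) fun v => ?_
    have hv := integral_star_dotProduct_mulVec k hki v
    rw [Matrix.sub_mulVec, dotProduct_sub, ← hv.2, Complex.sub_re]
    have e1 : (∫ s, star v ⬝ᵥ k s *ᵥ v ∂τ).re = ∫ s, (star v ⬝ᵥ k s *ᵥ v).re ∂τ :=
      (integral_re hv.1).symm
    have e2 : ∀ s, (star v ⬝ᵥ k s *ᵥ v).re = (s : ℝ)⁻¹ * (star v ⬝ᵥ h s *ᵥ v).re := by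
      intro s
      simp only [k, Matrix.smul_mulVec, dotProduct_smul, smul_eq_mul, Complex.re_ofReal_mul]
    rw [e1]
    simp_rw [e2]
    linarith [(hqb v).2.1]
  · simp [k]
  · intro z hz i j
    rw [hrep z hz i j, Matrix.sub_apply, Matrix.of_apply, ← integral_const_mul]
    have hpt : ∀ᵐ s : unitInterval ∂τ, (z - 1) * (1 / (1 + ((s : ℝ) : ℂ) * (z - 1)) * h s i j)
        = k s i j - 1 / (1 + ((s : ℝ) : ℂ) * (z - 1)) * k s i j := by
      filter_upwards [hk0] with s hs
      rw [hs i j]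
      have := one_div_mul_cancel (one_add_mul_sub_one_ne_zero hz s.2)
      linear_combination k s i j * this
    rw [integral_congr_ae hpt, integral_sub (hki i j) (integrable_slitKernel_mul hz (hki i j))]
    ring

lemma one_add_div_add_eq {z : ℂ} (hz : z ∈ Complex.slitPlane) {t : ℝ} (ht : 0 < t) :
    (1 + (t : ℂ)) / (z + t) = 1 / (1 + ((1 / (1 + t) : ℝ) : ℂ) * (z - 1)) := by
  have hs : 1 / (1 + t) ∈ Set.Icc (0 : ℝ) 1 :=
    ⟨by positivity, by rw [div_le_one (by positivity)]; linarith⟩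
  have h := one_add_mul_sub_one_ne_zero hz hs
  have ht' : (1 + (t : ℂ)) ≠ 0 := by exact_mod_cast (by positivity : (1 + t) ≠ 0)
  have e : 1 + ((1 / (1 + t) : ℝ) : ℂ) * (z - 1) = (z + t) / (1 + t) := by
    push_cast
    field_simp
    ring
  rw [e, one_div_div]

lemma integrable_one_add_div_add_mul {ν : Measure ℝ} (hν : ν (Set.Ioi (0 : ℝ))ᶜ = 0) {f : ℝ → ℂ}
    (hf : Integrable f ν) {z : ℂ} (hz : z ∈ Complex.slitPlane) :
    Integrable (fun t : ℝ => (1 + (t : ℂ)) / (z + t) * f t) ν := by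
  refine hf.bdd_mul (c := ‖slitKernel hz‖)
    (Measurable.aestronglyMeasurable (Measurable.div (by fun_prop) (by fun_prop))) ?_
  have h0 : ∀ᵐ t ∂ν, t ∈ Set.Ioi (0 : ℝ) := hν
  filter_upwards [h0] with t ht
  rw [one_add_div_add_eq hz ht]
  have ht : 0 < t := ht
  exact norm_slitKernel_le hz ⟨1 / (1 + t), by positivity, by
    rw [div_le_one (by positivity)]; linarith⟩

lemma isStieltjes_of_representation {d : ℕ} {F : ℂ → Matrix (Fin d) (Fin d) ℂ}
    {A C : Matrix (Fin d) (Fin d) ℂ} {ν : Measure ℝ} {g : ℝ → Matrix (Fin d) (Fin d) ℂ}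
    (hA : A.PosSemidef) (hC : C.PosSemidef) (hν : ν (Set.Ioi (0 : ℝ))ᶜ = 0)
    (hg : ∀ᵐ t ∂ν, (g t).PosSemidef) (hgi : ∀ i j, Integrable (fun t => g t i j) ν)
    (hrep : ∀ z ∈ Complex.slitPlane, ∀ i j,
      F z i j = A i j + C i j / z + ∫ t : ℝ, ((1 + (t : ℂ)) / (z + (t : ℂ))) * g t i j ∂ν) :
    IsStieltjes F := by
  have h0 : ∀ᵐ t ∂ν, 0 < t := hν
  refine ⟨fun z hz him => ?_, fun x hx => ?_⟩
  · have hz' : conj z ∈ Complex.slitPlane := by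
      rw [Complex.mem_slitPlane_iff] at hz ⊢
      simpa using hz
    have hzc : z - conj z ≠ 0 := by
      rw [Complex.sub_conj]
      simpa using him
    have hconj : ∀ i j, conj (F z j i) = A i j + C i j / conj z
        + ∫ t : ℝ, ((1 + (t : ℂ)) / (conj z + (t : ℂ))) * g t i j ∂ν := by
      intro i j
      have hinteg : conj (∫ t : ℝ, ((1 + (t : ℂ)) / (z + (t : ℂ))) * g t j i ∂ν)
          = ∫ t : ℝ, ((1 + (t : ℂ)) / (conj z + (t : ℂ))) * g t i j ∂ν := by
        rw [← integral_conj]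
        refine integral_congr_ae ?_
        filter_upwards [hg] with t ht
        have := ht.1.apply i j
        simp only [RCLike.star_def] at this
        simp only [map_mul, map_div₀, map_add, map_one, Complex.conj_ofReal, this]
      have hAij := hA.1.apply i j
      have hCij := hC.1.apply i j
      simp only [RCLike.star_def] at hAij hCij
      rw [hrep z hz j i, map_add, map_add, map_div₀, hAij, hCij, hinteg]
    let κ : ℝ → ℂ := fun t =>
      -(z - conj z)⁻¹ * ((1 + (t : ℂ)) / (z + t) - (1 + (t : ℂ)) / (conj z + t))
    have hκ : ∀ t : ℝ, 0 < t → 0 ≤ κ t := by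
      intro t ht
      have hw : z + t ≠ 0 := fun h => him (by simpa using congrArg Complex.im h)
      have hw' : conj z + t ≠ 0 := fun h => him (by simpa using congrArg Complex.im h)
      have e : κ t = (((1 + t) / Complex.normSq (z + t) : ℝ) : ℂ) := by
        push_cast
        rw [← Complex.mul_conj, map_add, Complex.conj_ofReal]
        simp only [κ]
        field_simp
        ring
      rw [e]
      exact_mod_cast div_nonneg (by linarith) (Complex.normSq_nonneg _)
    have hHi : ∀ i j, Integrable (fun t => (κ t • g t) i j) ν := by
      intro i j
      have := ((integrable_one_add_div_add_mul hν (hgi i j) hz).sub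
        (integrable_one_add_div_add_mul hν (hgi i j) hz')).const_mul (-(z - conj z)⁻¹)
      refine this.congr (Eventually.of_forall fun t => ?_)
      simp only [κ, Pi.sub_apply, Matrix.smul_apply, smul_eq_mul]
      ring
    have hP := posSemidef_integral (fun t => κ t • g t) hHi (by
      filter_upwards [h0, hg] with t ht hgt
      exact hgt.smul (hκ t ht))
    have hCn : (((1 / Complex.normSq z : ℝ) : ℂ) • C).PosSemidef :=
      hC.smul (by exact_mod_cast one_div_nonneg.2 (Complex.normSq_nonneg z))
    convert hCn.add hP using 1
    ext i j
    have hI : ∫ t, (κ t • g t) i j ∂ν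
        = -(z - conj z)⁻¹ * (∫ t : ℝ, ((1 + (t : ℂ)) / (z + (t : ℂ))) * g t i j ∂ν
          - ∫ t : ℝ, ((1 + (t : ℂ)) / (conj z + (t : ℂ))) * g t i j ∂ν) := by
      rw [← integral_sub (integrable_one_add_div_add_mul hν (hgi i j) hz)
        (integrable_one_add_div_add_mul hν (hgi i j) hz'), ← integral_const_mul]
      refine integral_congr_ae (Eventually.of_forall fun t => ?_)
      simp only [κ, Matrix.smul_apply, smul_eq_mul]
      ring
    simp only [Matrix.neg_apply, Matrix.smul_apply, Matrix.sub_apply, Matrix.conjTranspose_apply,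
      Matrix.add_apply, Matrix.of_apply, smul_eq_mul, RCLike.star_def] at hI ⊢
    rw [hI, hconj, hrep z hz i j]
    have hz0 : z ≠ 0 := Complex.slitPlane_ne_zero hz
    have hz0' : conj z ≠ 0 := Complex.slitPlane_ne_zero hz'
    have hCe : -((z - conj z)⁻¹ * (C i j / z - C i j / conj z))
        = ((1 / Complex.normSq z : ℝ) : ℂ) * C i j := by
      push_cast
      rw [← Complex.mul_conj]
      field_simp
      ring
    rw [← hCe]
    ring
  · have hz : (x : ℂ) ∈ Complex.slitPlane := Complex.ofReal_mem_slitPlane.2 hx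
    have hP := posSemidef_integral (fun t : ℝ => ((1 + (t : ℂ)) / ((x : ℂ) + t)) • g t)
      (fun i j => integrable_one_add_div_add_mul hν (hgi i j) hz) (by
        filter_upwards [h0, hg] with t ht hgt
        refine hgt.smul ?_
        have : 0 ≤ (1 + t) / (x + t) := by positivity
        exact_mod_cast this)
    have hCn : (((1 / x : ℝ) : ℂ) • C).PosSemidef :=
      hC.smul (by exact_mod_cast (one_div_pos.2 hx).le)
    convert (hA.add hCn).add hP using 1
    ext i j
    simp only [Matrix.add_apply, Matrix.of_apply, Matrix.smul_apply, smul_eq_mul]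
    rw [hrep _ hz i j]
    push_cast
    ring

lemma measurableEmbedding_inv_sub_one :
    MeasurableEmbedding fun s : unitInterval => (s : ℝ)⁻¹ - 1 := by
  have : StandardBorelSpace unitInterval := measurableSet_Icc.standardBorel
  refine Measurable.measurableEmbedding (by fun_prop) fun s t h => ?_
  exact Subtype.ext (inv_injective (sub_left_injective h))

lemma IsStieltjes.exists_representation {d : ℕ} {F : ℂ → Matrix (Fin d) (Fin d) ℂ}
    (hF : ∀ i j, DifferentiableOn ℂ (fun z => F z i j) Complex.slitPlane) (hS : IsStieltjes F) :
    ∃ (A C : Matrix (Fin d) (Fin d) ℂ) (ν : Measure ℝ) (g : ℝ → Matrix (Fin d) (Fin d) ℂ),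
      A.PosSemidef ∧ C.PosSemidef ∧ IsFiniteMeasure ν ∧ ν (Set.Ioi (0 : ℝ))ᶜ = 0 ∧
      (∀ᵐ t ∂ν, (g t).PosSemidef) ∧ (∀ i j, Integrable (fun t => g t i j) ν) ∧
      ∀ z ∈ Complex.slitPlane, ∀ i j, F z i j = A i j + C i j / z
        + ∫ t : ℝ, ((1 + (t : ℂ)) / (z + (t : ℂ))) * g t i j ∂ν := by
  obtain ⟨A, τ, k, hA, hτ, hki, hkp, hk0, hrep⟩ := hS.exists_compact_representation hF
  let T : unitInterval → ℝ := fun s => (s : ℝ)⁻¹ - 1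
  have hT : MeasurableEmbedding T := measurableEmbedding_inv_sub_one
  let U : Set unitInterval := Set.Ioo 0 1
  have hU : MeasurableSet U := measurableSet_Ioo
  let g : ℝ → Matrix (Fin d) (Fin d) ℂ := fun t => k (Set.projIcc 0 1 zero_le_one (1 / (1 + t)))
  have hgT : ∀ s, g (T s) = k s := by
    intro s
    have : 1 / (1 + T s) = s := by simp [T]
    simp only [g, this]
    rw [Set.projIcc_val]
  have hTpos : ∀ s ∈ U, 0 < T s := by
    intro s hs
    have h0 : (0 : ℝ) < s := hs.1
    have h1 : (s : ℝ) < 1 := hs.2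
    exact sub_pos.2 ((one_lt_inv₀ h0).2 h1)
  refine ⟨A, Matrix.of fun i j => ∫ s in {(1 : unitInterval)}, k s i j ∂τ,
    (τ.restrict U).map T, g, hA, ?_, inferInstance, ?_, ?_, ?_, ?_⟩
  · exact posSemidef_integral k (fun i j => (hki i j).restrict) (ae_restrict_of_ae hkp)
  · rw [Measure.map_apply hT.measurable measurableSet_Ioi.compl,
      Measure.restrict_apply (hT.measurable measurableSet_Ioi.compl)]
    convert measure_empty (μ := τ)
    ext s
    simp only [Set.mem_inter_iff, Set.mem_preimage, Set.mem_compl_iff, Set.mem_Ioi,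
      Set.mem_empty_iff_false, iff_false, not_and]
    exact fun h hs => h (hTpos s hs)
  · rw [hT.ae_map_iff]
    simp only [hgT]
    exact ae_restrict_of_ae hkp
  · intro i j
    rw [hT.integrable_map_iff]
    simp only [Function.comp_def, hgT]
    exact (hki i j).restrict
  · intro z hz i j
    have hinteg := integrable_slitKernel_mul hz (hki i j)
    rw [hrep z hz i j, ← integral_add_compl (measurableSet_singleton (1 : unitInterval)) hinteg,
      ← add_assoc]
    refine congrArg₂ _ (congrArg₂ _ rfl ?_) ?_
    · have : ∫ s in {(1 : unitInterval)}, 1 / (1 + ((s : ℝ) : ℂ) * (z - 1)) * k s i j ∂τ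
          = ∫ s in {(1 : unitInterval)}, 1 / z * k s i j ∂τ := by
        refine setIntegral_congr_fun (measurableSet_singleton _) fun s hs => ?_
        rw [Set.mem_singleton_iff.1 hs]
        simp
      rw [this, integral_const_mul, Matrix.of_apply]
      ring
    · rw [hT.integral_map]
      have hsub : U ⊆ {(1 : unitInterval)}ᶜ := fun s hs => hs.2.ne
      rw [setIntegral_eq_of_subset_of_forall_sdiff_eq_zero
        (measurableSet_singleton (1 : unitInterval)).compl hsub]
      · refine setIntegral_congr_fun hU fun s hs => ?_
        have h1 : 1 / (1 + T s) = s := by simp [T]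
        simp only [hgT]
        rw [one_add_div_add_eq hz (hTpos s hs), h1]
      · intro s hs
        have : s = 0 := by
          by_contra hne
          exact hs.2 ⟨unitInterval.pos_iff_ne_zero.2 hne, unitInterval.lt_one_iff_ne_one.2 hs.1⟩
        simp [this, hk0]

end

/-- A holomorphic `d × d`-matrix-valued function `F` on `ℂ ∖ (-∞, 0]`
belongs to the Stieltjes class `S⁻¹` (i.e. `(F(z) - F(z)ᴴ)/(z - conj z)` is negative
semidefinite for `Im z ≠ 0` and `F(x)` is positive semidefinite for real `x > 0`)
if and only if it admits the integral representation
`F(z) = A + C/z + ∫ 1/(z+t) dσ(t)` with `A, C ⪰ 0` and a positive-matrix-valued Borel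
measure `σ` on `(0, ∞)` with `∫ (1+t)⁻¹ dσ(t)` finite.  The measure `σ` is encoded by
a finite positive measure `ν` on `(0, ∞)` together with an a.e. positive semidefinite
matrix density `g` (so `dσ(t) = (1+t) g(t) dν(t)`), whence
`∫ 1/(z+t) dσ(t) = ∫ (1+t)/(z+t) g(t) dν(t)` entrywise. -/
theorem stmt_1 (d : ℕ) (hd : 1 ≤ d) (F : ℂ → Matrix (Fin d) (Fin d) ℂ)
    (hF : ∀ i j, DifferentiableOn ℂ (fun z => F z i j) Complex.slitPlane) :
    ((∀ z ∈ Complex.slitPlane, z.im ≠ 0 →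
        (-((z - conj z)⁻¹ • (F z - (F z)ᴴ))).PosSemidef) ∧
      (∀ x : ℝ, 0 < x → (F (x : ℂ)).PosSemidef))
    ↔ ∃ (A C : Matrix (Fin d) (Fin d) ℂ) (ν : Measure ℝ)
        (g : ℝ → Matrix (Fin d) (Fin d) ℂ),
        A.PosSemidef ∧ C.PosSemidef ∧ IsFiniteMeasure ν ∧
        ν (Set.Ioi (0:ℝ))ᶜ = 0 ∧
        (∀ᵐ t ∂ν, (g t).PosSemidef) ∧
        (∀ i j, Integrable (fun t => g t i j) ν) ∧
        (∀ z ∈ Complex.slitPlane, ∀ i j,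
          F z i j = A i j + C i j / z
            + ∫ t : ℝ, ((1 + (t : ℂ)) / (z + (t : ℂ))) * g t i j ∂ν) := by
  exact ⟨fun hS => IsStieltjes.exists_representation hF hS,
    fun ⟨A, C, ν, g, hA, hC, _, hν, hg, hgi, hrep⟩ =>
      isStieltjes_of_representation hA hC hν hg hgi hrep⟩
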